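/- arXiv:1705.04404 — 5 statements merged into one kernel-verified Lean document; each statement's English description precedes it below -/
import Mathlib

section
/- For all unit quaternions q₁, q₂, the map π satisfies π(q₁ · q₂) = π(q₁) · π(q₂), where on the left the product is quaternion multiplication and on the right it is matrix multiplication. In particular, π is a group homomorphism from the unit quaternions to SO(3). -/
open Matrix

noncomputable section

/-- The imaginary part of a quaternion, as a vector in ℝ³. -/
def qim (q : Quaternion ℝ) : Fin 3 → ℝ := ![q.imI, q.imJ, q.imK]

/-- The quaternion with scalar part `s` and vector (imaginary) part `v`. -/
def quat (s : ℝ) (v : Fin 3 → ℝ) : Quaternion ℝ := ⟨s, v 0, v 1, v 2⟩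

/-- The hat map sending `x ∈ ℝ³` to the skew-symmetric matrix `x̂` with `x̂ y = x × y`. -/
def hat (x : Fin 3 → ℝ) : Matrix (Fin 3) (Fin 3) ℝ :=
  !![0, -x 2, x 1; x 2, 0, -x 0; -x 1, x 0, 0]

/-- The map `π : S³ → SO(3)`, `π(q) = (2 qₛ² − 1) I₃ + 2 q_v q_vᵀ + 2 qₛ q̂_v`. -/
def piQ (q : Quaternion ℝ) : Matrix (Fin 3) (Fin 3) ℝ :=
  (2 * q.re ^ 2 - 1) • (1 : Matrix (Fin 3) (Fin 3) ℝ)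
    + (2 : ℝ) • Matrix.vecMulVec (qim q) (qim q)
    + (2 * q.re) • hat (qim q)

/-- The matrix `G(q) = qₛ I₃ − q̂_v` with `Im(q·(0,v)) = G(q)ᵀ v`. -/
def Gmat (q : Quaternion ℝ) : Matrix (Fin 3) (Fin 3) ℝ :=
  q.re • (1 : Matrix (Fin 3) (Fin 3) ℝ) - hat (qim q)

/-- The homogeneous quadratic form of the entries of `piQ q` for a unit quaternion `q`. -/
theorem piQ_eq_of_norm_eq_one {q : Quaternion ℝ} (h : ‖q‖ = 1) :
    piQ q =
      !![q.re ^ 2 + q.imI ^ 2 - q.imJ ^ 2 - q.imK ^ 2,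
          2 * (q.imI * q.imJ - q.re * q.imK), 2 * (q.imI * q.imK + q.re * q.imJ);
        2 * (q.imI * q.imJ + q.re * q.imK),
          q.re ^ 2 - q.imI ^ 2 + q.imJ ^ 2 - q.imK ^ 2, 2 * (q.imJ * q.imK - q.re * q.imI);
        2 * (q.imI * q.imK - q.re * q.imJ), 2 * (q.imJ * q.imK + q.re * q.imI),
          q.re ^ 2 - q.imI ^ 2 - q.imJ ^ 2 + q.imK ^ 2] := by
  have hq : q.re ^ 2 + q.imI ^ 2 + q.imJ ^ 2 + q.imK ^ 2 = 1 := by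
    rw [← Quaternion.normSq_def', Quaternion.normSq_eq_norm_mul_self, h, mul_one]
  ext i j
  fin_cases i <;> fin_cases j <;>
    simp [piQ, hat, qim] <;> linarith

/-- `piQ` is a group homomorphism from the unit quaternions to SO(3). -/
theorem piQ_mul (q₁ q₂ : Quaternion ℝ) (h₁ : ‖q₁‖ = 1) (h₂ : ‖q₂‖ = 1) :
    piQ (q₁ * q₂) = piQ q₁ * piQ q₂ := by
  rw [piQ_eq_of_norm_eq_one h₁, piQ_eq_of_norm_eq_one h₂,
    piQ_eq_of_norm_eq_one (by rw [norm_mul, h₁, h₂, mul_one])]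
  ext i j
  fin_cases i <;> fin_cases j <;> simp [Matrix.mul_apply, Fin.sum_univ_three] <;> ring
end
end

section
/- The map π from unit quaternions to SO(3) is surjective: for every 3×3 real matrix R with Rᵀ R = I₃ and det R = 1, there exists a unit quaternion q with π(q) = R. -/
open Matrix

noncomputable section

/-- A real matrix whose `2 × 2` minors through the diagonal vanish and which has a positive diagonal
entry is of the form `v vᵀ`. -/
theorem exists_eq_vecMulVec_self_of_minors {n : Type*} (K : Matrix n n ℝ)
    (hK : ∀ i j k, K i i * K j k = K i j * K i k) {i : n} (hi : 0 < K i i) :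
    ∃ v : n → ℝ, K = vecMulVec v v := by
  refine ⟨fun j => K i j / √(K i i), ?_⟩
  ext j k
  rw [vecMulVec_apply, div_mul_div_comm, Real.mul_self_sqrt hi.le, eq_div_iff hi.ne', ← hK, mul_comm]

/-- A special orthogonal matrix equals its cofactor matrix. -/
theorem adjugate_eq_transpose {n : Type*} [Fintype n] [DecidableEq n] (R : Matrix n n ℝ)
    (hR : Rᵀ * R = 1) (hdet : R.det = 1) : R.adjugate = Rᵀ := by
  calc R.adjugate = Rᵀ * R * R.adjugate := by rw [hR, one_mul]
    _ = Rᵀ := by rw [mul_assoc, mul_adjugate, hdet, one_smul, mul_one]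

/-- The matrix with entries `4 qᵢ qⱼ`, where `q` is a unit quaternion representing `R`. -/
def shepperd (R : Matrix (Fin 3) (Fin 3) ℝ) : Matrix (Fin 4) (Fin 4) ℝ :=
  !![1 + R 0 0 + R 1 1 + R 2 2, R 2 1 - R 1 2, R 0 2 - R 2 0, R 1 0 - R 0 1;
     R 2 1 - R 1 2, 1 + R 0 0 - R 1 1 - R 2 2, R 0 1 + R 1 0, R 0 2 + R 2 0;
     R 0 2 - R 2 0, R 0 1 + R 1 0, 1 - R 0 0 + R 1 1 - R 2 2, R 1 2 + R 2 1;
     R 1 0 - R 0 1, R 0 2 + R 2 0, R 1 2 + R 2 1, 1 - R 0 0 - R 1 1 + R 2 2]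

theorem shepperd_minors (R : Matrix (Fin 3) (Fin 3) ℝ) (hR : Rᵀ * R = 1) (hdet : R.det = 1)
    (i j k : Fin 4) :
    shepperd R i i * shepperd R j k = shepperd R i j * shepperd R i k := by
  have hadj := adjugate_eq_transpose R hR hdet
  have hR' := mul_eq_one_comm.mp hR
  rw [adjugate_fin_three] at hadj
  simp only [← Matrix.ext_iff, Fin.forall_fin_succ, Matrix.mul_apply, Fin.sum_univ_succ,
    Matrix.transpose_apply, Matrix.one_apply] at hadj hR hR'
  simp at hadj hR hR'
  obtain ⟨⟨_, _, _⟩, ⟨_, _, _⟩, _, _, _⟩ := hadj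
  obtain ⟨⟨_, _, _⟩, ⟨_, _, _⟩, _, _, _⟩ := hR
  obtain ⟨⟨_, _, _⟩, ⟨_, _, _⟩, _, _, _⟩ := hR'
  fin_cases i <;> fin_cases j <;> fin_cases k <;> simp [shepperd] <;> linarith

theorem exists_shepperd_diag_pos (R : Matrix (Fin 3) (Fin 3) ℝ) : ∃ i, 0 < shepperd R i i := by
  by_contra! h
  have h0 := h 0
  have h1 := h 1
  have h2 := h 2
  have h3 := h 3
  simp [shepperd] at h0 h1 h2 h3
  linarith

/-- `piQ` is surjective onto SO(3). -/
theorem piQ_surjective (R : Matrix (Fin 3) (Fin 3) ℝ)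
    (hR : Rᵀ * R = 1) (hdet : R.det = 1) :
    ∃ q : Quaternion ℝ, ‖q‖ = 1 ∧ piQ q = R := by
  obtain ⟨i, hi⟩ := exists_shepperd_diag_pos R
  obtain ⟨v, hv⟩ := exists_eq_vecMulVec_self_of_minors _ (shepperd_minors R hR hdet) hi
  simp only [← Matrix.ext_iff, Fin.forall_fin_succ, vecMulVec_apply] at hv
  simp [shepperd] at hv
  obtain ⟨⟨_, _, _, _⟩, ⟨_, _, _, _⟩, ⟨_, _, _, _⟩, _, _, _, _⟩ := hv
  refine ⟨quat (v 0 / 2) ![v 1 / 2, v 2 / 2, v 3 / 2], ?_, ?_⟩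
  · rw [← sq_eq_sq₀ (norm_nonneg _) zero_le_one, sq, ← Quaternion.normSq_eq_norm_mul_self,
      Quaternion.normSq_def']
    simp only [quat, Matrix.cons_val]
    linarith
  · ext j k
    fin_cases j <;> fin_cases k <;> simp [piQ, hat, qim, quat] <;> linarith
end
end

section
/- For unit quaternions p and q, π(p) = π(q) if and only if p = q or p = −q. Equivalently, the preimage under π of each rotation matrix in SO(3) is exactly a pair of antipodal unit quaternions. -/
open Matrix

noncomputable section

theorem piQ_neg (q : Quaternion ℝ) : piQ (-q) = piQ q := by
  ext i j
  fin_cases i <;> fin_cases j <;> simp [piQ, qim, hat]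

theorem Quaternion.sum_sq_eq_one {q : Quaternion ℝ} (hq : ‖q‖ = 1) :
    q.re ^ 2 + q.imI ^ 2 + q.imJ ^ 2 + q.imK ^ 2 = 1 := by
  rw [← Quaternion.normSq_def', Quaternion.normSq_eq_norm_mul_self, hq, one_mul]

/-- The inner product of two unit quaternions with the same rotation matrix squares to one:
the matrix determines all pairwise products of the four coordinates. -/
theorem inner_sq_eq_one_of_piQ_eq {p q : Quaternion ℝ} (hp : ‖p‖ = 1) (hq : ‖q‖ = 1)
    (h : piQ p = piQ q) : (inner ℝ p q : ℝ) ^ 2 = 1 := by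
  have hp' := Quaternion.sum_sq_eq_one hp
  have hq' := Quaternion.sum_sq_eq_one hq
  have entry (i j : Fin 3) : piQ p i j = piQ q i j := by rw [h]
  have h00 := entry 0 0
  have h01 := entry 0 1
  have h02 := entry 0 2
  have h10 := entry 1 0
  have h11 := entry 1 1
  have h12 := entry 1 2
  have h20 := entry 2 0
  have h21 := entry 2 1
  have h22 := entry 2 2
  simp [piQ, qim, hat] at h00 h01 h02 h10 h11 h12 h20 h21 h22
  have hss : p.re ^ 2 = q.re ^ 2 := by linarith
  have hxx : p.imI ^ 2 = q.imI ^ 2 := by linarith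
  have hyy : p.imJ ^ 2 = q.imJ ^ 2 := by linarith
  have hzz : p.imK ^ 2 = q.imK ^ 2 := by linarith
  have hxy : p.imI * p.imJ = q.imI * q.imJ := by linarith
  have hxz : p.imI * p.imK = q.imI * q.imK := by linarith
  have hyz : p.imJ * p.imK = q.imJ * q.imK := by linarith
  have hsx : p.re * p.imI = q.re * q.imI := by linarith
  have hsy : p.re * p.imJ = q.re * q.imJ := by linarith
  have hsz : p.re * p.imK = q.re * q.imK := by linarith
  have hinner : (inner ℝ p q : ℝ) =
      p.re * q.re + p.imI * q.imI + p.imJ * q.imJ + p.imK * q.imK := by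
    simp [Quaternion.inner_def]
  rw [hinner]
  linear_combination
    (p.re ^ 2 + p.imI ^ 2 + p.imJ ^ 2 + p.imK ^ 2 + 1) * hp'
      - p.re ^ 2 * hss - p.imI ^ 2 * hxx - p.imJ ^ 2 * hyy - p.imK ^ 2 * hzz
      - 2 * (p.imI * p.imJ) * hxy - 2 * (p.imI * p.imK) * hxz - 2 * (p.imJ * p.imK) * hyz
      - 2 * (p.re * p.imI) * hsx - 2 * (p.re * p.imJ) * hsy - 2 * (p.re * p.imK) * hsz

/-- For unit quaternions `p`, `q`, the rotations agree iff the quaternions are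
equal or antipodal. -/
theorem piQ_eq_iff_antipodal (p q : Quaternion ℝ) (hp : ‖p‖ = 1) (hq : ‖q‖ = 1) :
    piQ p = piQ q ↔ p = q ∨ p = -q := by
  constructor
  · intro h
    rcases eq_or_eq_neg_of_sq_eq_sq _ 1
        ((inner_sq_eq_one_of_piQ_eq hp hq h).trans (one_pow 2).symm) with h1 | h1
    · exact Or.inl ((inner_eq_one_iff_of_norm_eq_one (𝕜 := ℝ) hp hq).mp h1)
    · refine Or.inr ((inner_eq_one_iff_of_norm_eq_one (𝕜 := ℝ) hp (by rwa [norm_neg])).mp ?_)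
      rw [inner_neg_right, h1, neg_neg]
  · rintro (rfl | rfl)
    · rfl
    · exact piQ_neg q
end
end

section
/- Let q : ℝ → Quaternion ℝ be a differentiable curve of unit quaternions and ξ : ℝ → ℝ³ such that q'(t) = q(t) · (0, ξ(t)) for all t. Then the curve of rotation matrices R(t) = π(q(t)) satisfies R'(t) = R(t) · (2 ξ(t))^∧ for all t, where ∧ denotes the hat map. -/
open Matrix

noncomputable section

/-- Each real-linear functional of a differentiable quaternion curve has the expected derivative. -/
theorem hasDerivAt_quaternion_linearMap {q : ℝ → Quaternion ℝ} {q' : Quaternion ℝ} {t : ℝ}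
    (h : HasDerivAt q q' t) (l : Quaternion ℝ →ₗ[ℝ] ℝ) :
    HasDerivAt (fun s => l (q s)) (l q') t :=
  (LinearMap.toContinuousLinearMap l).hasFDerivAt.comp_hasDerivAt t h

@[simp] theorem quat_re (s : ℝ) (v : Fin 3 → ℝ) : (quat s v).re = s := rfl

@[simp] theorem quat_imI (s : ℝ) (v : Fin 3 → ℝ) : (quat s v).imI = v 0 := rfl

@[simp] theorem quat_imJ (s : ℝ) (v : Fin 3 → ℝ) : (quat s v).imJ = v 1 := rfl

@[simp] theorem quat_imK (s : ℝ) (v : Fin 3 → ℝ) : (quat s v).imK = v 2 := rfl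

/-- If `q` is a differentiable curve of unit quaternions whose derivative is
`q * quat 0 (ξ t)`, then the curve of rotation matrices `piQ ∘ q` has entrywise
derivative `piQ (q t) * hat (2 • ξ t)`. -/
theorem deriv_piQ (q : ℝ → Quaternion ℝ) (ξ : ℝ → Fin 3 → ℝ)
    (hdiff : Differentiable ℝ q) (hunit : ∀ t, ‖q t‖ = 1)
    (hq' : ∀ t, deriv q t = q t * quat 0 (ξ t)) :
    ∀ t i j, deriv (fun s => piQ (q s) i j) t
      = (piQ (q t) * hat ((2 : ℝ) • ξ t)) i j := by
  intro t i j
  have hq : HasDerivAt q (q t * quat 0 (ξ t)) t := hq' t ▸ (hdiff t).hasDerivAt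
  have hre : HasDerivAt (fun s => (q s).re) (q t * quat 0 (ξ t)).re t :=
    hasDerivAt_quaternion_linearMap hq (QuaternionAlgebra.reₗ _ _ _)
  have hv : ∀ k, HasDerivAt (fun s => qim (q s) k) (qim (q t * quat 0 (ξ t)) k) t := by
    intro k
    fin_cases k
    · exact hasDerivAt_quaternion_linearMap hq (QuaternionAlgebra.imIₗ _ _ _)
    · exact hasDerivAt_quaternion_linearMap hq (QuaternionAlgebra.imJₗ _ _ _)
    · exact hasDerivAt_quaternion_linearMap hq (QuaternionAlgebra.imKₗ _ _ _)
  have hhat : HasDerivAt (fun s => hat (qim (q s)) i j) (hat (qim (q t * quat 0 (ξ t))) i j) t := by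
    fin_cases i <;> fin_cases j <;>
      first
      | exact hasDerivAt_const t (0 : ℝ)
      | exact hv 0
      | exact hv 1
      | exact hv 2
      | exact (hv 0).neg
      | exact (hv 1).neg
      | exact (hv 2).neg
  have key := ((((hre.pow 2).const_mul 2).sub_const 1).mul_const
    ((1 : Matrix (Fin 3) (Fin 3) ℝ) i j)).add (((hv i).mul (hv j)).const_mul 2) |>.add
    ((hre.const_mul 2).mul hhat)
  have hn : (q t).re ^ 2 + (q t).imI ^ 2 + (q t).imJ ^ 2 + (q t).imK ^ 2 = 1 := by
    rw [← Quaternion.normSq_def', Quaternion.normSq_eq_norm_mul_self, hunit t, one_mul]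
  refine (HasDerivAt.deriv key).trans ?_
  clear key hhat hv hre hq hq' hunit hdiff
  fin_cases i <;> fin_cases j <;>
    simp [piQ, hat, qim, Matrix.mul_apply, Fin.sum_univ_three] <;>
    grind
end
end

section
/- Let q₀, q₁ be unit quaternions, J a symmetric 3×3 real matrix, and η ∈ ℝ³. Let q₁(λ) be a differentiable curve of unit quaternions with q₁(0) = q₁ and q₁'(0) = q₁ · (0, η). Then d/dλ |_{λ=0} ⟨Im(q₀* · q₁(λ)), J · Im(q₀* · q₁(λ))⟩ = 2 ⟨G(q₀* q₁) · J · Im(q₀* q₁), η⟩, where G(p) = p_s I₃ − p̂_v for p = (p_s, p_v). -/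
open Matrix

noncomputable section

theorem HasDerivAt.dotProduct {ι : Type*} [Fintype ι] {u v : ℝ → ι → ℝ} {u' v' : ι → ℝ} {x : ℝ}
    (hu : HasDerivAt u u' x) (hv : HasDerivAt v v' x) :
    HasDerivAt (fun l => u l ⬝ᵥ v l) (u' ⬝ᵥ v x + u x ⬝ᵥ v') x := by
  simp only [_root_.dotProduct, ← Finset.sum_add_distrib]
  exact HasDerivAt.fun_sum fun i _ => (hasDerivAt_pi.1 hu i).mul (hasDerivAt_pi.1 hv i)

theorem HasDerivAt.mulVec {ι κ : Type*} [Fintype ι] [Fintype κ] (A : Matrix κ ι ℝ)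
    {u : ℝ → ι → ℝ} {u' : ι → ℝ} {x : ℝ} (hu : HasDerivAt u u' x) :
    HasDerivAt (fun l => A *ᵥ u l) (A *ᵥ u') x :=
  A.mulVecLin.toContinuousLinearMap.hasFDerivAt.comp_hasDerivAt x hu

theorem HasDerivAt.dotProduct_mulVec_self {ι : Type*} [Fintype ι] {A : Matrix ι ι ℝ}
    (hA : Aᵀ = A) {u : ℝ → ι → ℝ} {u' : ι → ℝ} {x : ℝ} (hu : HasDerivAt u u' x) :
    HasDerivAt (fun l => u l ⬝ᵥ (A *ᵥ u l)) (2 * (u' ⬝ᵥ (A *ᵥ u x))) x := by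
  convert hu.dotProduct (hu.mulVec A) using 1
  rw [Matrix.dotProduct_mulVec (u x), ← Matrix.mulVec_transpose, hA, dotProduct_comm _ u', two_mul]

/-- `qim` as a linear map. -/
def qimLinear : Quaternion ℝ →ₗ[ℝ] (Fin 3 → ℝ) where
  toFun := qim
  map_add' p q := by ext i; fin_cases i <;> simp [qim]
  map_smul' r q := by ext i; fin_cases i <;> simp [qim]

theorem HasDerivAt.qim {c : ℝ → Quaternion ℝ} {c' : Quaternion ℝ} {x : ℝ}
    (hc : HasDerivAt c c' x) : HasDerivAt (fun l => qim (c l)) (qim c') x :=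
  qimLinear.toContinuousLinearMap.hasFDerivAt.comp_hasDerivAt x hc

theorem qim_mul_quat_zero (p : Quaternion ℝ) (v : Fin 3 → ℝ) :
    qim (p * quat 0 v) = (Gmat p)ᵀ *ᵥ v := by
  have hre : (quat 0 v).re = 0 := rfl
  have hI : (quat 0 v).imI = v 0 := rfl
  have hJ : (quat 0 v).imJ = v 1 := rfl
  have hK : (quat 0 v).imK = v 2 := rfl
  ext i
  fin_cases i <;>
    simp [qim, hre, hI, hJ, hK, Gmat, hat, Matrix.mulVec, _root_.dotProduct,
      Fin.sum_univ_three] <;> ring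

/-- Derivative of the discrete rotational kinetic term along a variation
`c` of `q₁` generated by `η`. -/
theorem deriv_discrete_kinetic (q₀ q₁ : Quaternion ℝ) (h₀ : ‖q₀‖ = 1) (h₁ : ‖q₁‖ = 1)
    (J : Matrix (Fin 3) (Fin 3) ℝ) (hJ : Jᵀ = J) (η : Fin 3 → ℝ)
    (c : ℝ → Quaternion ℝ) (hc : ∀ l, ‖c l‖ = 1) (hc0 : c 0 = q₁)
    (hc' : HasDerivAt c (q₁ * quat 0 η) 0) :
    deriv (fun l => qim (star q₀ * c l) ⬝ᵥ (J *ᵥ qim (star q₀ * c l))) 0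
      = 2 * ((Gmat (star q₀ * q₁) *ᵥ (J *ᵥ qim (star q₀ * q₁))) ⬝ᵥ η) := by
  subst hc0
  rw [((hc'.const_mul (star q₀)).qim.dotProduct_mulVec_self hJ).deriv, ← mul_assoc,
    qim_mul_quat_zero, Matrix.mulVec_transpose, ← Matrix.dotProduct_mulVec, dotProduct_comm η]
end
end
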